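/- Components of complexified octonionic monogenic functions are ultrahyperbolic harmonic: if f : 𝕆 × 𝕆 → 𝕆_ℂ is twice continuously differentiable and D f = 0 everywhere, then 𝓛 f := Δ_x f − Δ_y f + 2 i • Σ_{j=0}^{7} ∂_{x_j}(∂_{y_j} f) vanishes everywhere (in particular every scalar component function of f lies in the kernel of the ultrahyperbolic operator 𝓛). -/

import Mathlib

noncomputable section

open scoped BigOperators

/-- The quaternions over ℝ. -/
abbrev ℍ := Quaternion ℝ

/-- The octonions, modeled as Cayley–Dickson pairs of quaternions. -/
abbrev 𝕆 := ℍ × ℍ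

/-- Cayley–Dickson multiplication on 𝕆 = ℍ × ℍ. -/
def omul (x y : 𝕆) : 𝕆 :=
  (x.1 * y.1 - star y.2 * x.2, x.2 * star y.1 + y.2 * x.1)

/-- The quaternion unit i. -/
def qi : ℍ := ⟨0, 1, 0, 0⟩
/-- The quaternion unit j. -/
def qj : ℍ := ⟨0, 0, 1, 0⟩
/-- The quaternion unit k. -/
def qk : ℍ := ⟨0, 0, 0, 1⟩

/-- The standard basis e₀,…,e₇ of 𝕆 ≅ ℝ⁸. -/
def e : Fin 8 → 𝕆 :=
  ![(1, 0), (qi, 0), (qj, 0), (qk, 0), (0, 1), (0, qi), (0, qj), (0, qk)]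

/-- The complexified octonions 𝕆_ℂ, modeled as pairs `(g, h)` standing for `g + i·h`. -/
abbrev 𝕆ℂ := 𝕆 × 𝕆

/-- Multiplication by the complex imaginary unit: `i • (g, h) = (−h, g)`. -/
def iSmul (z : 𝕆ℂ) : 𝕆ℂ := (-z.2, z.1)

/-- Left multiplication of 𝕆_ℂ by an octonion: `a • (g, h) = (a*g, a*h)`. -/
def eSmul (a : 𝕆) (z : 𝕆ℂ) : 𝕆ℂ := (omul a z.1, omul a z.2)

/-- `∂_x F = ∂_{x_0}F + Σ_{j=1}^7 e_j * ∂_{x_j}F` for octonion-valued `F`. -/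
def PxO (F : 𝕆 × 𝕆 → 𝕆) (p : 𝕆 × 𝕆) : 𝕆 :=
  fderiv ℝ F p (e 0, 0) + ∑ j : Fin 7, omul (e j.succ) (fderiv ℝ F p (e j.succ, 0))

/-- `∂_y F = ∂_{y_0}F + Σ_{j=1}^7 e_j * ∂_{y_j}F` for octonion-valued `F`. -/
def PyO (F : 𝕆 × 𝕆 → 𝕆) (p : 𝕆 × 𝕆) : 𝕆 :=
  fderiv ℝ F p (0, e 0) + ∑ j : Fin 7, omul (e j.succ) (fderiv ℝ F p (0, e j.succ))

/-- `∂_x f = ∂_{x_0}f + Σ_{j=1}^7 e_j • ∂_{x_j}f` for 𝕆_ℂ-valued `f`. -/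
def Px (f : 𝕆 × 𝕆 → 𝕆ℂ) (p : 𝕆 × 𝕆) : 𝕆ℂ :=
  fderiv ℝ f p (e 0, 0) + ∑ j : Fin 7, eSmul (e j.succ) (fderiv ℝ f p (e j.succ, 0))

/-- `∂_x̄ f = ∂_{x_0}f − Σ_{j=1}^7 e_j • ∂_{x_j}f` for 𝕆_ℂ-valued `f`. -/
def Pxbar (f : 𝕆 × 𝕆 → 𝕆ℂ) (p : 𝕆 × 𝕆) : 𝕆ℂ :=
  fderiv ℝ f p (e 0, 0) - ∑ j : Fin 7, eSmul (e j.succ) (fderiv ℝ f p (e j.succ, 0))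

/-- `∂_y f = ∂_{y_0}f + Σ_{j=1}^7 e_j • ∂_{y_j}f` for 𝕆_ℂ-valued `f`. -/
def Py (f : 𝕆 × 𝕆 → 𝕆ℂ) (p : 𝕆 × 𝕆) : 𝕆ℂ :=
  fderiv ℝ f p (0, e 0) + ∑ j : Fin 7, eSmul (e j.succ) (fderiv ℝ f p (0, e j.succ))

/-- `∂_ȳ f = ∂_{y_0}f − Σ_{j=1}^7 e_j • ∂_{y_j}f` for 𝕆_ℂ-valued `f`. -/
def Pybar (f : 𝕆 × 𝕆 → 𝕆ℂ) (p : 𝕆 × 𝕆) : 𝕆ℂ :=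
  fderiv ℝ f p (0, e 0) - ∑ j : Fin 7, eSmul (e j.succ) (fderiv ℝ f p (0, e j.succ))

/-- The complexified octonionic Cauchy–Riemann operator `D f = ∂_x f + i • ∂_y f`. -/
def D (f : 𝕆 × 𝕆 → 𝕆ℂ) (p : 𝕆 × 𝕆) : 𝕆ℂ := Px f p + iSmul (Py f p)

/-- The octonionic conjugate operator `D̄ f = ∂_x̄ f + i • ∂_ȳ f`. -/
def Dbar (f : 𝕆 × 𝕆 → 𝕆ℂ) (p : 𝕆 × 𝕆) : 𝕆ℂ := Pxbar f p + iSmul (Pybar f p)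

/-- The Hermitian conjugate operator `D⁺ f = ∂_x̄ f − i • ∂_ȳ f`. -/
def Dplus (f : 𝕆 × 𝕆 → 𝕆ℂ) (p : 𝕆 × 𝕆) : 𝕆ℂ := Pxbar f p - iSmul (Pybar f p)

/-- `Δ_x f(p) = Σ_{j=0}^7` (second derivative of `f` at `p` twice in direction `(e_j, 0)`). -/
def lapX {E : Type*} [NormedAddCommGroup E] [NormedSpace ℝ E]
    (f : 𝕆 × 𝕆 → E) (p : 𝕆 × 𝕆) : E :=
  ∑ j : Fin 8, fderiv ℝ (fderiv ℝ f) p ((e j, 0) : 𝕆 × 𝕆) ((e j, 0) : 𝕆 × 𝕆)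

/-- `Δ_y f(p) = Σ_{j=0}^7` (second derivative of `f` at `p` twice in direction `(0, e_j)`). -/
def lapY {E : Type*} [NormedAddCommGroup E] [NormedSpace ℝ E]
    (f : 𝕆 × 𝕆 → E) (p : 𝕆 × 𝕆) : E :=
  ∑ j : Fin 8, fderiv ℝ (fderiv ℝ f) p ((0, e j) : 𝕆 × 𝕆) ((0, e j) : 𝕆 × 𝕆)

/-- The mixed term `Σ_{j=0}^7 ∂_{x_j} ∂_{y_j} f (p)`. -/
def mixXY {E : Type*} [NormedAddCommGroup E] [NormedSpace ℝ E]
    (f : 𝕆 × 𝕆 → E) (p : 𝕆 × 𝕆) : E :=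
  ∑ j : Fin 8, fderiv ℝ (fun q => fderiv ℝ f q ((0, e j) : 𝕆 × 𝕆)) p ((e j, 0) : 𝕆 × 𝕆)

/-- The ultrahyperbolic operator `𝓛 f = Δ_x f − Δ_y f + 2 i • Σ_j ∂_{x_j}∂_{y_j} f`. -/
def UH (f : 𝕆 × 𝕆 → 𝕆ℂ) (p : 𝕆 × 𝕆) : 𝕆ℂ :=
  lapX f p - lapY f p + (2 : ℝ) • iSmul (mixXY f p)

/-- Octonionic conjugation. -/
def oconj (a : 𝕆) : 𝕆 := (star a.1, -a.2)

/-- The Euclidean inner product on 𝕆 ≅ ℝ⁸. -/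
def oinner (a b : 𝕆) : ℝ :=
  a.1.re * b.1.re + a.1.imI * b.1.imI + a.1.imJ * b.1.imJ + a.1.imK * b.1.imK +
    (a.2.re * b.2.re + a.2.imI * b.2.imI + a.2.imJ * b.2.imJ + a.2.imK * b.2.imK)

/-- The polarized form of `ā * (a * v) = |a|² v`. -/
theorem omul_oconj_polarized (a b v : 𝕆) :
    omul (oconj a) (omul b v) + omul (oconj b) (omul a v) = (2 * oinner a b) • v := by
  obtain ⟨a, a'⟩ := a
  obtain ⟨b, b'⟩ := b
  obtain ⟨v, v'⟩ := v
  refine Prod.ext (Quaternion.ext _ _ ?_ ?_ ?_ ?_) (Quaternion.ext _ _ ?_ ?_ ?_ ?_) <;>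
  · simp only [omul, oconj, oinner, Prod.fst_add, Prod.snd_add, Prod.smul_fst, Prod.smul_snd,
      Quaternion.re_add, Quaternion.imI_add, Quaternion.imJ_add, Quaternion.imK_add,
      Quaternion.re_sub, Quaternion.imI_sub, Quaternion.imJ_sub, Quaternion.imK_sub,
      Quaternion.re_neg, Quaternion.imI_neg, Quaternion.imJ_neg, Quaternion.imK_neg,
      Quaternion.re_mul, Quaternion.imI_mul, Quaternion.imJ_mul, Quaternion.imK_mul,
      Quaternion.re_star, Quaternion.imI_star, Quaternion.imJ_star, Quaternion.imK_star,
      Quaternion.re_smul, Quaternion.imI_smul, Quaternion.imJ_smul, Quaternion.imK_smul,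
      smul_eq_mul]
    ring

open scoped Quaternion in
theorem oinner_e (j k : Fin 8) : oinner (e j) (e k) = if j = k then 1 else 0 := by
  fin_cases j <;> fin_cases k <;> simp [oinner, e, qi, qj, qk]

theorem omul_add (a x y : 𝕆) : omul a (x + y) = omul a x + omul a y := by
  ext1 <;> simp only [omul, Prod.fst_add, Prod.snd_add, star_add, mul_add, add_mul] <;> abel

theorem omul_smul (a : 𝕆) (c : ℝ) (x : 𝕆) : omul a (c • x) = c • omul a x := by
  ext1 <;> simp [omul, smul_sub]

theorem omul_e_zero (x : 𝕆) : omul (e 0) x = x := by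
  ext1 <;> simp [omul, e]

/-- `eSmul a` as a continuous linear map. -/
def eSmulL (a : 𝕆) : 𝕆ℂ →L[ℝ] 𝕆ℂ :=
  LinearMap.toContinuousLinearMap
    { toFun := eSmul a
      map_add' := fun x y => by simp [eSmul, omul_add]
      map_smul' := fun c x => by simp [eSmul, omul_smul] }

@[simp] theorem eSmulL_apply (a : 𝕆) (z : 𝕆ℂ) : eSmulL a z = eSmul a z := rfl

/-- `iSmul` as a continuous linear map. -/
def iSmulL : 𝕆ℂ →L[ℝ] 𝕆ℂ :=
  LinearMap.toContinuousLinearMap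
    { toFun := iSmul
      map_add' := fun x y => by ext1 <;> simp [iSmul, add_comm]
      map_smul' := fun c x => by ext1 <;> simp [iSmul] }

@[simp] theorem iSmulL_apply (z : 𝕆ℂ) : iSmulL z = iSmul z := rfl

theorem iSmul_iSmul (z : 𝕆ℂ) : iSmul (iSmul z) = -z := rfl

theorem omul_neg (a x : 𝕆) : omul a (-x) = -omul a x := by
  simpa using omul_smul a (-1) x

theorem eSmul_iSmul (a : 𝕆) (z : 𝕆ℂ) : eSmul a (iSmul z) = iSmul (eSmul a z) := by
  ext1 <;> simp [eSmul, iSmul, omul_neg]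

theorem eSmul_oconj_e (j k : Fin 8) (z : 𝕆ℂ) :
    eSmul (oconj (e k)) (eSmul (e j) z) + eSmul (oconj (e j)) (eSmul (e k) z) =
      if j = k then (2 : ℝ) • z else 0 := by
  have h : eSmul (oconj (e k)) (eSmul (e j) z) + eSmul (oconj (e j)) (eSmul (e k) z) =
      (2 * oinner (e k) (e j)) • z :=
    Prod.ext (omul_oconj_polarized _ _ z.1) (omul_oconj_polarized _ _ z.2)
  rw [h, oinner_e]
  by_cases hjk : j = k <;> simp [hjk, eq_comm]

/-- If a symmetric array is annihilated by left contraction with the basis, it has zero trace. -/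
theorem sum_diag_eq_zero {C : Fin 8 → Fin 8 → 𝕆ℂ} (hC : ∀ j k, C j k = C k j)
    (h : ∀ k, ∑ j, eSmul (e j) (C j k) = 0) : ∑ j, C j j = 0 := by
  have h1 : ∑ k, ∑ j, eSmul (oconj (e k)) (eSmul (e j) (C j k)) = 0 := by
    refine Finset.sum_eq_zero fun k _ => ?_
    have := congrArg (eSmulL (oconj (e k))) (h k)
    simpa only [map_sum, map_zero, eSmulL_apply] using this
  have h2 : ∑ k, ∑ j, eSmul (oconj (e j)) (eSmul (e k) (C j k)) = 0 := by
    rw [Finset.sum_comm]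
    simpa only [hC] using h1
  have h3 : ∑ k, ∑ j, (if j = k then (2 : ℝ) • C j k else 0) = 0 := by
    simp only [← eSmul_oconj_e, Finset.sum_add_distrib, h1, h2, add_zero]
  simpa [← Finset.smul_sum] using h3

theorem hasFDerivAt_clm_fderiv {E F G : Type*} [NormedAddCommGroup E] [NormedSpace ℝ E]
    [NormedAddCommGroup F] [NormedSpace ℝ F] [NormedAddCommGroup G] [NormedSpace ℝ G]
    (Φ : (E →L[ℝ] F) →L[ℝ] G) {f : E → F} {p : E} (hf : DifferentiableAt ℝ (fderiv ℝ f) p) :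
    HasFDerivAt (fun q => Φ (fderiv ℝ f q)) (Φ.comp (fderiv ℝ (fderiv ℝ f) p)) p :=
  Φ.hasFDerivAt.comp p hf.hasFDerivAt

/-- The principal symbol of `D`, acting on differentials. -/
def symbolD : (𝕆 × 𝕆 →L[ℝ] 𝕆ℂ) →L[ℝ] 𝕆ℂ :=
  ∑ j, (eSmulL (e j)).comp
    (ContinuousLinearMap.apply ℝ 𝕆ℂ (e j, 0) +
      iSmulL.comp (ContinuousLinearMap.apply ℝ 𝕆ℂ (0, e j)))

theorem symbolD_apply (A : 𝕆 × 𝕆 →L[ℝ] 𝕆ℂ) :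
    symbolD A = ∑ j, eSmul (e j) (A (e j, 0) + iSmul (A (0, e j))) := by
  simp only [symbolD, sum_apply]
  rfl

theorem D_eq_symbolD (f : 𝕆 × 𝕆 → 𝕆ℂ) (p : 𝕆 × 𝕆) : D f p = symbolD (fderiv ℝ f p) := by
  have h0 (z : 𝕆ℂ) : eSmul (e 0) z = z := Prod.ext (omul_e_zero _) (omul_e_zero _)
  rw [symbolD_apply, Fin.sum_univ_succ, D, Px, Py, h0]
  simp only [← iSmulL_apply, ← eSmulL_apply, map_add, map_sum, Finset.sum_add_distrib]
  simp only [iSmulL_apply, eSmulL_apply, eSmul_iSmul]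
  abel

/-- Components of complexified octonionic monogenic functions are
ultrahyperbolic harmonic: if `f` is twice continuously differentiable and
`D f = 0` everywhere, then `𝓛 f = 0` everywhere. -/
theorem monogenic_ultrahyperbolic (f : 𝕆 × 𝕆 → 𝕆ℂ) (hf : ContDiff ℝ 2 f)
    (hD : ∀ p, D f p = 0) : ∀ p, UH f p = 0 := by
  intro p
  have hf' : DifferentiableAt ℝ (fderiv ℝ f) p :=
    (hf.fderiv_right (m := 1) (by norm_num)).differentiable one_ne_zero p
  set B := fderiv ℝ (fderiv ℝ f) p with hB
  have hsymm (u v : 𝕆 × 𝕆) : B u v = B v u :=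
    (hf.contDiffAt.isSymmSndFDerivAt (by simp)).eq u v
  have hzero (u : 𝕆 × 𝕆) : symbolD (B u) = 0 := by
    have h1 : HasFDerivAt (fun q => symbolD (fderiv ℝ f q)) (symbolD.comp B) p :=
      hasFDerivAt_clm_fderiv symbolD hf'
    simp only [← D_eq_symbolD, hD] at h1
    exact DFunLike.congr_fun (h1.unique (hasFDerivAt_const 0 p)) u
  have hmix (j : Fin 8) : fderiv ℝ (fun q => fderiv ℝ f q ((0, e j) : 𝕆 × 𝕆)) p (e j, 0) =
      B (e j, 0) (0, e j) := by
    rw [fderiv_clm_apply hf' (differentiableAt_const _)]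
    simp [hB]
  have htrace := sum_diag_eq_zero
    (C := fun j k => (B (e k, 0) (e j, 0) + iSmul (B (e k, 0) (0, e j))) +
      iSmul (B (0, e k) (e j, 0) + iSmul (B (0, e k) (0, e j))))
    (fun j k => by
      rw [hsymm (e k, 0) (e j, 0), hsymm (e k, 0) (0, e j), hsymm (0, e k) (e j, 0),
        hsymm (0, e k) (0, e j)]
      simp only [← iSmulL_apply, map_add]
      abel)
    (fun k => by
      have h1 := hzero (e k, 0)
      have h2 := congrArg iSmulL (hzero (0, e k))
      rw [symbolD_apply] at h1 h2
      simp only [map_sum, map_zero, iSmulL_apply, ← eSmul_iSmul] at h2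
      simp only [← eSmulL_apply] at h1 h2 ⊢
      simp only [map_add _ (_ + _) (iSmul _), Finset.sum_add_distrib] at h1 h2 ⊢
      rw [h1, h2, add_zero])
  rw [← htrace, UH, lapX, lapY, mixXY]
  simp only [hmix, ← hB, fun j => hsymm (0, e j) (e j, 0), ← iSmulL_apply, map_add, map_sum,
    Finset.sum_add_distrib]
  simp only [iSmulL_apply, iSmul_iSmul, Finset.sum_neg_distrib, two_smul]
  abel
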